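/- arXiv:1703.08814 — 2 statements merged into one kernel-verified Lean document; each statement's English description precedes it below -/
import Mathlib

section
/- Let f : ℝ → ℝ be a smooth compactly supported odd function. Then the iterated integral ∫_ℝ (∫_ℝ f(t) e^{iρt} dt) · coth(πρ/2) dρ equals ∫_ℝ f(t) · 2i coth(t) dt. -/
open Real MeasureTheory

/-- Hyperbolic cotangent. -/
noncomputable def Real.coth (x : ℝ) : ℝ := Real.cosh x / Real.sinh x

lemma cp_int_exp_sin {a : ℝ} (ha : 0 < a) (t : ℝ) :
    ∫ ρ in Set.Ioi (0:ℝ), Real.sin (ρ * t) * Real.exp (-(a * ρ)) = t / (a ^ 2 + t ^ 2) := by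
  have hre : ((-a : ℂ) + Complex.I * t).re < 0 := by simp [ha]
  have h := integral_exp_mul_complex_Ioi hre 0
  have hi := integrableOn_exp_mul_complex_Ioi hre 0
  have h2 := congrArg Complex.im h
  have h3 := integral_im (𝕜 := ℂ) hi
  simp only [RCLike.im_to_complex] at h3
  rw [← h3] at h2
  convert h2 using 1
  · refine integral_congr_ae (Filter.Eventually.of_forall fun ρ => ?_)
    simp only [Complex.exp_im]
    simp
    ring_nf
  · simp [Complex.div_im, Complex.normSq_apply]
    ring

lemma cp_swap (f : ℝ → ℝ) (hc : Continuous f) (hf : Integrable f) {a : ℝ} (ha : 0 < a) :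
    ∫ ρ in Set.Ioi (0:ℝ), (∫ t, f t * Real.sin (ρ * t)) * Real.exp (-(a * ρ))
      = ∫ t, f t * (t / (a ^ 2 + t ^ 2)) := by
  have he : IntegrableOn (fun ρ : ℝ => Real.exp (-(a * ρ))) (Set.Ioi 0) := by
    simpa using integrableOn_exp_mul_Ioi (a := -a) (by linarith) 0
  simp_rw [← integral_mul_const]
  rw [integral_integral_swap]
  · refine integral_congr_ae (Filter.Eventually.of_forall fun t => ?_)
    simp only
    rw [← cp_int_exp_sin ha t, ← integral_const_mul]
    simp_rw [mul_assoc]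
  · have := he.mul_prod hf
    refine this.mono ?_ ?_
    · apply Continuous.aestronglyMeasurable
      simp only [Function.uncurry_def]
      fun_prop
    · refine Filter.Eventually.of_forall fun p => ?_
      simp only [Function.uncurry_def, norm_mul]
      have h1 : ‖Real.sin (p.1 * p.2)‖ ≤ 1 := Real.abs_sin_le_one _
      have := mul_nonneg (norm_nonneg (f p.2)) (norm_nonneg (Real.exp (-(a * p.1))))
      nlinarith

lemma cp_coth_series {t : ℝ} (ht : t ≠ 0) :
    HasSum (fun n : ℕ => 2 * (t / ((((n:ℝ) + 1) * π) ^ 2 + t ^ 2))) (Real.coth t - 1 / t) := by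
  have hpi : (π:ℂ) ≠ 0 := by exact_mod_cast Real.pi_ne_zero
  have htc : (t:ℂ) ≠ 0 := by exact_mod_cast ht
  set x : ℂ := Complex.I * t / π with hx
  have hxm : x ∈ Complex.integerComplement := by
    rw [Complex.mem_integerComplement_iff]
    rintro ⟨n, hn⟩
    have h := congrArg Complex.im hn
    have : x = ((t / π : ℝ) : ℂ) * Complex.I := by rw [hx]; push_cast; ring
    rw [this] at h
    simp only [Complex.intCast_im, Complex.im_ofReal_mul, Complex.I_im, mul_one] at h
    have : t / π ≠ 0 := div_ne_zero ht Real.pi_ne_zero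
    exact this h.symm
  have hs := (summable_cotTerm hxm).hasSum
  have hrep := cot_series_rep' hxm
  simp only [cotTerm] at hs
  rw [← hrep] at hs
  have hs2 := hs.mul_left (Complex.I / π)
  rw [← Complex.hasSum_ofReal]
  convert! hs2 using 1
  · funext n
    have hden : ((((n:ℂ) + 1) * π) ^ 2 + (t:ℂ) ^ 2) ≠ 0 := by
      have : ((((n:ℝ) + 1) * π) ^ 2 + t ^ 2) ≠ 0 := by positivity
      exact_mod_cast this
    have h1 : x - (n + 1) ≠ 0 := by
      intro h
      exact hxm ⟨(n + 1 : ℤ), by push_cast; linear_combination -h⟩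
    have h2 : x + (n + 1) ≠ 0 := by
      intro h
      exact hxm ⟨-(n + 1 : ℤ), by push_cast; linear_combination -h⟩
    have h3 : (x - (n+1)) * (x + (n+1)) = - ((((n:ℂ) + 1) * π) ^ 2 + (t:ℂ) ^ 2) / π ^ 2 := by
      rw [hx]; field_simp; ring_nf; simp
      try ring
    have h4 : (1 / (x - (n + 1)) + 1 / (x + (n + 1))) = 2 * x / ((x - (n+1)) * (x + (n+1))) := by
      field_simp; ring
    rw [h4, h3, hx]
    push_cast
    field_simp
    simp [neg_div]
  · have hpx : (π:ℂ) * x = t * Complex.I := by rw [hx]; field_simp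
    rw [hpx, Complex.cot, Complex.cos_mul_I, Complex.sin_mul_I, hx, Real.coth]
    have hsh : Complex.sinh t ≠ 0 := by
      rw [← Complex.ofReal_sinh]; exact_mod_cast Real.sinh_ne_zero.mpr ht
    push_cast
    field_simp

lemma cp_coth_exp {ρ : ℝ} (hρ : 0 < ρ) :
    HasSum (fun n : ℕ => 2 * Real.exp (-((((n:ℝ) + 1) * π) * ρ))) (Real.coth (π * ρ / 2) - 1) := by
  have hq : Real.exp (-(π * ρ)) < 1 := by
    rw [Real.exp_lt_one_iff]; have := Real.pi_pos; nlinarith [mul_pos this hρ]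
  have h := (hasSum_geometric_of_lt_one (Real.exp_nonneg _) hq).mul_left (2 * Real.exp (-(π * ρ)))
  convert! h using 1
  · funext n
    rw [← Real.exp_nat_mul, mul_assoc 2 (Real.exp _), ← Real.exp_add]
    congr 2; ring
  · rw [show Real.coth (π * ρ / 2) = Real.cosh (π * ρ / 2) / Real.sinh (π * ρ / 2) from rfl, Real.cosh_eq, Real.sinh_eq]
    have e1 : Real.exp (-(π * ρ)) = Real.exp (-(π * ρ / 2)) * Real.exp (-(π * ρ / 2)) := by
      rw [← Real.exp_add]; congr 1; ring
    have e2 : Real.exp (π * ρ / 2) * Real.exp (-(π * ρ / 2)) = 1 := by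
      rw [← Real.exp_add]; simp
    have e3 : 1 - Real.exp (-(π * ρ)) ≠ 0 := by linarith
    have e4 : Real.exp (-(π * ρ / 2)) ≠ 0 := (Real.exp_pos _).ne'
    have e5 : Real.exp (π * ρ / 2) = 1 / Real.exp (-(π * ρ / 2)) := by field_simp; exact e2
    rw [e1] at e3 ⊢
    rw [e5]
    generalize Real.exp (-(π * ρ / 2)) = q at *
    have e6 : 1 / q - q ≠ 0 := by
      intro h; apply e3; field_simp at h; linarith
    field_simp
    have e7 : 1 - q ^ 2 ≠ 0 := by rwa [pow_two]
    field_simp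
    ring

open FourierTransform in
lemma cp_S_integrable (f : ℝ → ℝ) (hsm : ContDiff ℝ (⊤ : ℕ∞) f) (hsupp : HasCompactSupport f) :
    Integrable (fun ρ : ℝ => ∫ t, f t * Real.sin (ρ * t)) := by
  have hF : ContDiff ℝ (⊤ : ℕ∞) (fun t => (f t : ℂ)) := Complex.ofRealCLM.contDiff.comp hsm
  have hFs : HasCompactSupport (fun t => (f t : ℂ)) := hsupp.comp_left (g := fun x : ℝ => (x:ℂ)) rfl
  have hint : Integrable f := hsm.continuous.integrable_of_hasCompactSupport hsupp
  have hS : Integrable (𝓕 (fun t => (f t : ℂ))) := by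
    have := (𝓕 (hFs.toSchwartzMap hF)).integrable (μ := volume)
    rwa [SchwartzMap.fourier_coe] at this
  have h2 := (hS.comp_mul_left' (R := -(1 / (2 * π))) (by have := Real.pi_pos; simp [this.ne'])).im
  refine h2.congr (Filter.Eventually.of_forall fun ρ => ?_)
  simp only [Real.fourier_real_eq_integral_exp_smul]
  rw [← integral_im]
  · refine integral_congr_ae (Filter.Eventually.of_forall fun t => ?_)
    simp only [smul_eq_mul, RCLike.im_to_complex, Complex.im_mul_ofReal, Complex.exp_ofReal_mul_I_im]
    rw [mul_comm]
    congr 2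
    have := Real.pi_ne_zero
    field_simp
  · refine (hint.ofReal (𝕜 := ℂ)).bdd_mul (c := 1) ?_ ?_
    · apply Continuous.aestronglyMeasurable; fun_prop
    · refine Filter.Eventually.of_forall fun t => ?_
      rw [Complex.norm_exp_ofReal_mul_I]

lemma cp_div_integrable (f : ℝ → ℝ) (hsm : ContDiff ℝ (⊤ : ℕ∞) f) (hsupp : HasCompactSupport f)
    (h0 : f 0 = 0) : Integrable (fun t : ℝ => f t * (1 / t)) := by
  obtain ⟨K, hK⟩ := ContDiff.lipschitzWith_of_hasCompactSupport hsupp hsm (by simp)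
  have hi : Integrable ((tsupport f).indicator (fun _ : ℝ => (K:ℝ))) := by
    rw [integrable_indicator_iff (isClosed_tsupport f).measurableSet]
    exact integrableOn_const hsupp.isCompact.measure_lt_top.ne
  refine hi.mono' ?_ (Filter.Eventually.of_forall fun t => ?_)
  · have := hsm.continuous.measurable
    exact (by fun_prop : Measurable _).aestronglyMeasurable
  · by_cases ht : t ∈ tsupport f
    · rw [Set.indicator_of_mem ht]
      by_cases h : t = 0
      · simp [h]
      have := hK.dist_le_mul t 0
      simp only [dist_eq_norm, h0, sub_zero] at this
      rw [norm_mul, norm_div, norm_one, mul_one_div, div_le_iff₀ (norm_pos_iff.mpr h)]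
      exact this
    · rw [Set.indicator_of_notMem ht, image_eq_zero_of_notMem_tsupport ht]; simp

lemma cp_zero (f : ℝ → ℝ) (hsm : ContDiff ℝ (⊤ : ℕ∞) f) (hsupp : HasCompactSupport f)
    (h0 : f 0 = 0) :
    ∫ ρ in Set.Ioi (0:ℝ), (∫ t, f t * Real.sin (ρ * t)) = ∫ t, f t * (1 / t) := by
  have hS := cp_S_integrable f hsm hsupp
  have hint : Integrable f := hsm.continuous.integrable_of_hasCompactSupport hsupp
  have hd := cp_div_integrable f hsm hsupp h0
  set S : ℝ → ℝ := fun ρ : ℝ => ∫ t, f t * Real.sin (ρ * t) with hSdef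
  have hpos : ∀ᶠ a : ℝ in nhdsWithin 0 (Set.Ioi 0), 0 < a := self_mem_nhdsWithin
  have h1 : Filter.Tendsto (fun a : ℝ => ∫ ρ in Set.Ioi (0:ℝ), S ρ * Real.exp (-(a * ρ)))
      (nhdsWithin 0 (Set.Ioi 0)) (nhds (∫ ρ in Set.Ioi (0:ℝ), S ρ)) := by
    apply tendsto_integral_filter_of_dominated_convergence (fun ρ => ‖S ρ‖)
    · refine Filter.Eventually.of_forall fun a => ?_
      exact hS.aestronglyMeasurable.restrict.mul
        (Continuous.aestronglyMeasurable (by fun_prop))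
    · filter_upwards [hpos] with a ha
      rw [ae_restrict_iff' measurableSet_Ioi]
      refine Filter.Eventually.of_forall fun ρ hρ => ?_
      rw [norm_mul]
      have : ‖Real.exp (-(a * ρ))‖ ≤ 1 := by
        rw [Real.norm_eq_abs, Real.abs_exp, Real.exp_le_one_iff]
        have := mul_pos ha (Set.mem_Ioi.mp hρ)
        linarith
      exact mul_le_of_le_one_right (norm_nonneg _) this
    · exact hS.norm.restrict
    · refine Filter.Eventually.of_forall fun ρ => ?_
      have : Continuous (fun a : ℝ => S ρ * Real.exp (-(a * ρ))) := by fun_prop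
      have h := (this.tendsto 0).mono_left (nhdsWithin_le_nhds (s := Set.Ioi 0))
      simpa using h
  have h2 : Filter.Tendsto (fun a : ℝ => ∫ t, f t * (t / (a ^ 2 + t ^ 2)))
      (nhdsWithin 0 (Set.Ioi 0)) (nhds (∫ t, f t * (1 / t))) := by
    apply tendsto_integral_filter_of_dominated_convergence (fun t => ‖f t * (1 / t)‖)
    · refine Filter.Eventually.of_forall fun a => ?_
      have := hsm.continuous.measurable
      exact (by fun_prop : Measurable _).aestronglyMeasurable
    · refine Filter.Eventually.of_forall fun a => Filter.Eventually.of_forall fun t => ?_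
      rw [norm_mul, norm_mul]
      refine mul_le_mul_of_nonneg_left ?_ (norm_nonneg _)
      by_cases ht : t = 0
      · simp [ht]
      have hp : 0 < t ^ 2 := by positivity
      rw [norm_div, norm_div, norm_one, Real.norm_of_nonneg (by positivity : 0 ≤ a ^ 2 + t ^ 2),
        div_le_div_iff₀ (by positivity) (norm_pos_iff.mpr ht), Real.norm_eq_abs, abs_mul_abs_self]
      nlinarith [sq_nonneg a]
    · exact hd.norm
    · refine Filter.Eventually.of_forall fun t => ?_
      by_cases ht : t = 0
      · simp [ht]
      have hc : ContinuousAt (fun a : ℝ => f t * (t / (a ^ 2 + t ^ 2))) 0 := by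
        have : (0:ℝ) ^ 2 + t ^ 2 ≠ 0 := by positivity
        fun_prop (disch := assumption)
      have h := hc.tendsto.mono_left (nhdsWithin_le_nhds (s := Set.Ioi 0))
      have e : t / (0 ^ 2 + t ^ 2) = 1 / t := by field_simp; simp
      simp only [e] at h
      exact h
  refine tendsto_nhds_unique (h1.congr' ?_) h2
  filter_upwards [hpos] with a ha
  exact cp_swap f hsm.continuous hint ha

lemma cp_half (f : ℝ → ℝ) (hsm : ContDiff ℝ (⊤ : ℕ∞) f) (hsupp : HasCompactSupport f)
    (h0 : f 0 = 0) :
    ∫ ρ in Set.Ioi (0:ℝ), (∫ t, f t * Real.sin (ρ * t)) * Real.coth (π * ρ / 2)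
      = ∫ t, f t * Real.coth t := by
  have hS := cp_S_integrable f hsm hsupp
  have hc := hsm.continuous
  have hint : Integrable f := hc.integrable_of_hasCompactSupport hsupp
  have hd := cp_div_integrable f hsm hsupp h0
  have hz := cp_zero f hsm hsupp h0
  have hsw := fun n : ℕ => cp_swap f hc hint (a := ((n:ℝ) + 1) * π) (by positivity)
  have hft : Integrable (fun t => |f t| * |t|) :=
    (hc.abs.mul continuous_abs).integrable_of_hasCompactSupport (hsupp.abs.mul_right)
  have hSb : ∀ ρ : ℝ, |∫ t, f t * Real.sin (ρ * t)| ≤ (∫ t, |f t| * |t|) * |ρ| := by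
    intro ρ
    rw [← integral_mul_const]
    refine norm_integral_le_of_norm_le (f := fun t => f t * Real.sin (ρ * t)) (hft.mul_const _) (Filter.Eventually.of_forall fun t => ?_)
    rw [norm_mul, mul_assoc]
    refine mul_le_mul_of_nonneg_left ?_ (norm_nonneg _)
    calc |Real.sin (ρ * t)| ≤ |ρ * t| := Real.abs_sin_le_abs
      _ = |t| * |ρ| := by rw [abs_mul, mul_comm]
  set S : ℝ → ℝ := fun ρ : ℝ => ∫ t, f t * Real.sin (ρ * t) with hSdef
  set C : ℝ := ∫ t, |f t| * |t| with hC
  have hC0 : 0 ≤ C := integral_nonneg fun t => by positivity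
  have hsumsq : Summable (fun n : ℕ => 2 * C * (1 / (((n:ℝ) + 1) * π)) ^ 2) := by
    have h := (summable_nat_add_iff 1).mpr (Real.summable_one_div_nat_pow.mpr (by norm_num : 1 < 2))
    refine (h.mul_left (2 * C / π ^ 2)).congr fun n => ?_
    have := Real.pi_ne_zero
    push_cast
    field_simp
  -- the two families
  let A : ℕ → ℝ → ℝ := fun n ρ => Nat.casesOn n (S ρ)
    (fun m => S ρ * (2 * Real.exp (-((((m:ℝ) + 1) * π) * ρ))))
  let B : ℕ → ℝ → ℝ := fun n t => Nat.casesOn n (f t * (1 / t))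
    (fun m => f t * (2 * (t / ((((m:ℝ) + 1) * π) ^ 2 + t ^ 2))))
  have hAB : ∀ n, ∫ ρ in Set.Ioi (0:ℝ), A n ρ = ∫ t, B n t := by
    rintro (_ | n)
    · exact hz
    · simp only [A, B]
      have e1 : ∀ ρ, S ρ * (2 * Real.exp (-((((n:ℝ) + 1) * π) * ρ)))
          = 2 * (S ρ * Real.exp (-((((n:ℝ) + 1) * π) * ρ))) := fun ρ => by ring
      have e2 : ∀ t, f t * (2 * (t / ((((n:ℝ) + 1) * π) ^ 2 + t ^ 2)))
          = 2 * (f t * (t / ((((n:ℝ) + 1) * π) ^ 2 + t ^ 2))) := fun t => by ring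
      simp_rw [e1, e2]
      rw [integral_const_mul, integral_const_mul, hsw n]
  have hAi : ∀ n, IntegrableOn (A n) (Set.Ioi 0) := by
    rintro (_ | n)
    · exact hS.restrict
    · simp only [A]
      refine hS.restrict.mul_bdd (c := 2) ?_ ?_
      · exact Continuous.aestronglyMeasurable (by fun_prop)
      · rw [ae_restrict_iff' measurableSet_Ioi]
        refine Filter.Eventually.of_forall fun ρ hρ => ?_
        have hρ' : 0 < ρ := hρ
        rw [Real.norm_of_nonneg (by positivity)]
        have : Real.exp (-((((n:ℝ) + 1) * π) * ρ)) ≤ 1 := by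
          rw [Real.exp_le_one_iff]
          have : 0 < ((n:ℝ) + 1) * π * ρ := by positivity
          linarith
        linarith
  have hAs : Summable fun n => ∫ ρ in Set.Ioi (0:ℝ), ‖A n ρ‖ := by
    rw [← summable_nat_add_iff 1]
    refine Summable.of_nonneg_of_le (fun n => integral_nonneg fun _ => norm_nonneg _)
      (fun n => ?_) hsumsq
    have ha : 0 < ((n:ℝ) + 1) * π := by positivity
    have key := Real.integral_rpow_mul_exp_neg_mul_Ioi (a := 2) (by norm_num) ha
    have hki : IntegrableOn (fun ρ : ℝ => ρ ^ ((2:ℝ) - 1) * Real.exp (-((((n:ℝ) + 1) * π) * ρ)))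
        (Set.Ioi 0) := .of_integral_ne_zero (by rw [key]; simp; positivity)
    have hG : Real.Gamma 2 = 1 := by simp
    have e : 2 * C * (1 / (((n:ℝ) + 1) * π)) ^ 2 = ∫ ρ in Set.Ioi (0:ℝ),
        2 * C * (ρ ^ ((2:ℝ) - 1) * Real.exp (-((((n:ℝ) + 1) * π) * ρ))) := by
      rw [integral_const_mul, key, hG, mul_one]
      norm_cast
    rw [e]
    refine setIntegral_mono_on (hAi (n+1)).norm (hki.const_mul _) measurableSet_Ioi ?_
    intro ρ hρ
    have hρ' : 0 < ρ := hρ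
    have hb := hSb ρ
    rw [abs_of_pos hρ'] at hb
    have e1 : ρ ^ ((2:ℝ) - 1) = ρ := by norm_num
    simp only [A, e1]
    rw [norm_mul, Real.norm_of_nonneg (by positivity : (0:ℝ) ≤ 2 * Real.exp _), Real.norm_eq_abs]
    calc _ ≤ C * ρ * (2 * Real.exp (-((((n:ℝ) + 1) * π) * ρ))) :=
          mul_le_mul_of_nonneg_right hb (by positivity)
      _ = _ := by ring
  have hBb : ∀ (n : ℕ) t, ‖B (n+1) t‖ ≤ (|f t| * |t|) * (2 * (1 / (((n:ℝ) + 1) * π)) ^ 2) := by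
    intro n t
    simp only [B]
    have ha : 0 < ((n:ℝ) + 1) * π := by positivity
    rw [norm_mul, norm_mul, norm_div, Real.norm_of_nonneg (by positivity : 0 ≤ (((n:ℝ) + 1) * π) ^ 2 + t ^ 2)]
    simp only [Real.norm_eq_abs, abs_two]
    have : |t| / ((((n:ℝ) + 1) * π) ^ 2 + t ^ 2) ≤ |t| * (1 / (((n:ℝ) + 1) * π)) ^ 2 := by
      rw [div_pow, one_pow, mul_one_div]
      refine div_le_div_of_nonneg_left (abs_nonneg _) (by positivity) ?_
      nlinarith [sq_nonneg t]
    calc _ ≤ |f t| * (2 * (|t| * (1 / (((n:ℝ) + 1) * π)) ^ 2)) := by gcongr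
      _ = _ := by ring
  have hBi : ∀ n, Integrable (B n) := by
    rintro (_ | n)
    · exact hd
    · refine (hft.mul_const (2 * (1 / (((n:ℝ) + 1) * π)) ^ 2)).mono' ?_
        (Filter.Eventually.of_forall (hBb n))
      have := hc.measurable
      exact (by fun_prop : Measurable (B (n+1))).aestronglyMeasurable
  have hBs : Summable fun n => ∫ t, ‖B n t‖ := by
    rw [← summable_nat_add_iff 1]
    refine Summable.of_nonneg_of_le (fun n => integral_nonneg fun _ => norm_nonneg _)
      (fun n => ?_) hsumsq
    have h := integral_mono (hBi (n+1)).norm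
      (hft.mul_const (2 * (1 / (((n:ℝ) + 1) * π)) ^ 2)) (hBb n)
    rw [integral_mul_const] at h
    refine h.trans (le_of_eq (by ring))
  have H1 := hasSum_integral_of_summable_integral_norm hAi hAs
  have H2 := hasSum_integral_of_summable_integral_norm hBi hBs
  simp_rw [hAB] at H1
  have H3 := H1.unique H2
  have E1 : ∫ ρ in Set.Ioi (0:ℝ), ∑' n, A n ρ
      = ∫ ρ in Set.Ioi (0:ℝ), S ρ * Real.coth (π * ρ / 2) := by
    refine setIntegral_congr_fun measurableSet_Ioi fun ρ hρ => ?_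
    have h := ((cp_coth_exp hρ).mul_left (S ρ)).zero_add (f := fun n => A n ρ)
    refine h.tsum_eq.trans ?_
    have hA0 : A 0 ρ = S ρ := rfl
    rw [hA0]
    ring
  have E2 : ∫ t, ∑' n, B n t = ∫ t, f t * Real.coth t := by
    refine integral_congr_ae (Filter.Eventually.of_forall fun t => ?_)
    simp only
    by_cases ht : t = 0
    · have : ∀ n, B n t = 0 := by rintro (_ | n) <;> simp [B, ht]
      simp only [this, tsum_zero]
      simp [ht, h0]
    have h := ((cp_coth_series ht).mul_left (f t)).zero_add (f := fun n => B n t)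
    rw [h.tsum_eq]
    have hB0 : B 0 t = f t * (1 / t) := rfl
    rw [hB0]
    ring
  rw [← E1, ← E2, H3]

theorem fourier_coth_pairing (f : ℝ → ℝ) (hsm : ContDiff ℝ (⊤ : ℕ∞) f)
    (hsupp : HasCompactSupport f) (hodd : ∀ t, f (-t) = -f t) :
    (∫ ρ : ℝ, (∫ t : ℝ, (f t : ℂ) * Complex.exp (Complex.I * (ρ : ℂ) * (t : ℂ)))
        * (Real.coth (π * ρ / 2) : ℂ))
      = ∫ t : ℝ, (f t : ℂ) * (2 * Complex.I * (Real.coth t : ℂ)) := by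
  have h0 : f 0 = 0 := by have := hodd 0; simp at this; linarith
  have hc := hsm.continuous
  have hhalf := cp_half f hsm hsupp h0
  have hg : ∀ ρ : ℝ, (∫ t : ℝ, (f t : ℂ) * Complex.exp (Complex.I * (ρ : ℂ) * (t : ℂ)))
      = Complex.I * ((∫ t, f t * Real.sin (ρ * t) : ℝ) : ℂ) := by
    intro ρ
    have hcos : ∫ t, f t * Real.cos (ρ * t) = 0 := by
      have h := integral_neg_eq_self (fun t => f t * Real.cos (ρ * t)) volume
      simp only [hodd, mul_neg, Real.cos_neg, neg_mul, integral_neg] at h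
      linarith
    have i1 : Integrable (fun t => f t * Real.cos (ρ * t)) :=
      Continuous.integrable_of_hasCompactSupport (by fun_prop) hsupp.mul_right
    have i2 : Integrable (fun t => f t * Real.sin (ρ * t)) :=
      Continuous.integrable_of_hasCompactSupport (by fun_prop) hsupp.mul_right
    have e : ∀ t : ℝ, (f t : ℂ) * Complex.exp (Complex.I * (ρ : ℂ) * (t : ℂ))
        = ((f t * Real.cos (ρ * t) : ℝ) : ℂ) + Complex.I * ((f t * Real.sin (ρ * t) : ℝ) : ℂ) := by
      intro t
      rw [show Complex.I * (ρ : ℂ) * (t : ℂ) = ((ρ * t : ℝ) : ℂ) * Complex.I by push_cast; ring,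
        Complex.exp_mul_I]
      push_cast
      ring
    simp_rw [e]
    have i1' : Integrable (fun t => ((f t * Real.cos (ρ * t) : ℝ) : ℂ)) := i1.ofReal
    have i2' : Integrable (fun t => ((f t * Real.sin (ρ * t) : ℝ) : ℂ)) := i2.ofReal
    rw [integral_add i1' (i2'.const_mul _), integral_const_mul, integral_complex_ofReal, integral_complex_ofReal,
      hcos]
    simp
  simp_rw [hg]
  have hsinh_odd : ∀ x, Real.coth (-x) = - Real.coth x := by
    intro x
    simp only [Real.coth, Real.cosh_neg, Real.sinh_neg, div_neg]
  have hev : ∀ ρ : ℝ, (∫ t, f t * Real.sin (ρ * t)) * Real.coth (π * ρ / 2)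
      = (∫ t, f t * Real.sin (|ρ| * t)) * Real.coth (π * |ρ| / 2) := by
    intro ρ
    rcases abs_choice ρ with h | h
    · rw [h]
    · rw [h]
      rw [show π * -ρ / 2 = -(π * ρ / 2) by ring, hsinh_odd]
      simp only [neg_mul, Real.sin_neg, mul_neg, integral_neg, neg_neg]
  have e1 : ∀ ρ : ℝ, Complex.I * ((∫ t, f t * Real.sin (ρ * t) : ℝ) : ℂ)
        * (Real.coth (π * ρ / 2) : ℂ)
      = Complex.I * (((∫ t, f t * Real.sin (ρ * t)) * Real.coth (π * ρ / 2) : ℝ) : ℂ) := by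
    intro ρ; push_cast; ring
  have e2 : ∀ t : ℝ, (f t : ℂ) * (2 * Complex.I * (Real.coth t : ℂ))
      = 2 * Complex.I * ((f t * Real.coth t : ℝ) : ℂ) := by
    intro t; push_cast; ring
  simp_rw [e1, e2]
  rw [integral_const_mul, integral_const_mul, integral_complex_ofReal, integral_complex_ofReal, ← hhalf]
  have h3 : ∫ ρ, (∫ t, f t * Real.sin (ρ * t)) * Real.coth (π * ρ / 2) = _ :=
    (integral_congr_ae (Filter.Eventually.of_forall hev)).trans
    (integral_comp_abs (f := fun ρ => (∫ t, f t * Real.sin (ρ * t)) * Real.coth (π * ρ / 2)))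
  rw [h3]
  push_cast
  ring
end

section
/- Let f : ℝ → ℝ be a smooth compactly supported odd function. Then the iterated integral ∫_ℝ (∫_ℝ f(t) e^{iρt} dt) · tanh(πρ/2) dρ equals ∫_ℝ f(t) · (2i / sinh(t)) dt. -/
open Real MeasureTheory
open scoped FourierTransform

lemma HasSum.congr_aux {f g : ℕ → ℂ} {a : ℂ} (h : HasSum f a) (e : ∀ k, g k = f k) : HasSum g a := by
  rwa [funext e]

lemma aux_tanh (r : ℝ) : HasSum (fun n : ℕ => (4 / π) * (r / (r ^ 2 + (2 * (n : ℝ) + 1) ^ 2)))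
    (Real.tanh (π * r / 2)) := by
  by_cases hr : r = 0
  · subst hr; simp
  have mem : ∀ s : ℝ, s ≠ 0 → Complex.I * (s : ℂ) ∈ Complex.integerComplement := by
    rintro s hs ⟨n, hn⟩
    have := congrArg Complex.im hn
    simp at this
    exact hs this.symm
  have h1 := mem r hr
  have h2 := mem (r / 2) (by simpa using hr)
  have s1 := (summable_cotTerm h1)
  have s2 := (summable_cotTerm h2).hasSum
  have e1 := cot_series_rep' h1
  have e2 := cot_series_rep' h2
  have ev : Summable (fun k : ℕ => cotTerm (Complex.I * r) (2 * k)) :=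
    s1.comp_injective (i := fun k : ℕ => 2 * k) (fun a b h => by simpa using h)
  have od : HasSum (fun k : ℕ => cotTerm (Complex.I * r) (2 * k + 1))
      ((∑' n, cotTerm (Complex.I * ((r / 2 : ℝ) : ℂ)) n) / 2) := by
    refine HasSum.congr_aux (s2.div_const 2) ?_
    intro k
    have hne1 := Complex.integerComplement_add_ne_zero h2 ((k : ℤ) + 1)
    have hne2 := Complex.integerComplement_add_ne_zero h2 (-((k : ℤ) + 1))
    simp only [cotTerm]
    push_cast at hne1 hne2 ⊢
    have a1 : Complex.I * (r : ℂ) - (2 * k + 1 + 1) = 2 * (Complex.I * (r / 2) + -(k + 1)) := by ring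
    have a2 : Complex.I * (r : ℂ) + (2 * k + 1 + 1) = 2 * (Complex.I * (r / 2) + (k + 1)) := by ring
    rw [a1, a2, sub_eq_add_neg]
    field_simp
  have key := (ev.hasSum.even_add_odd od).unique s1.hasSum
  have e1' : ∑' n, cotTerm (Complex.I * r) n = π * Complex.cot (π * (Complex.I * r)) - 1 / (Complex.I * r) := e1.symm
  have e2' : ∑' n, cotTerm (Complex.I * ((r / 2 : ℝ) : ℂ)) n = π * Complex.cot (π * (Complex.I * ((r / 2 : ℝ) : ℂ))) - 1 / (Complex.I * ((r / 2 : ℝ) : ℂ)) := e2.symm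
  have hrC : (r : ℂ) ≠ 0 := by exact_mod_cast hr
  have val : ∑' k, cotTerm (Complex.I * r) (2 * k) = -(π / 2) * Complex.I * (Real.tanh (π * r / 2) : ℂ) := by
    have : ∑' k, cotTerm (Complex.I * r) (2 * k) = π * Complex.cot (π * (Complex.I * r)) - (π / 2) * Complex.cot (π * (Complex.I * ((r / 2 : ℝ) : ℂ))) := by
      rw [eq_sub_of_add_eq key, e1', e2']
      push_cast
      field_simp
      ring
    rw [this]
    have b1 : (π : ℂ) * (Complex.I * r) = 2 * ((π * r / 2 : ℝ) * Complex.I) := by push_cast; ring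
    have b2 : (π : ℂ) * (Complex.I * ((r / 2 : ℝ) : ℂ)) = ((π * r / 2 : ℝ) * Complex.I) := by push_cast; ring
    rw [b1, b2]
    have hs0 : Real.sinh (π * r / 2) ≠ 0 := by
      rw [Ne, Real.sinh_eq_zero]
      have := Real.pi_ne_zero
      positivity
    have hs : Complex.sinh ((π * r / 2 : ℝ) : ℂ) ≠ 0 := by
      rw [← Complex.ofReal_sinh]; exact_mod_cast hs0
    have hc : Complex.cosh ((π * r / 2 : ℝ) : ℂ) ≠ 0 := by
      rw [← Complex.ofReal_cosh]; exact_mod_cast (Real.cosh_pos _).ne'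
    have hI := Complex.I_sq
    have hcs := Complex.cosh_sq ((π * r / 2 : ℝ) : ℂ)
    rw [Complex.ofReal_tanh, Complex.tanh_eq_sinh_div_cosh, Complex.cot, Complex.cot, Complex.cos_two_mul,
      Complex.sin_two_mul, Complex.cos_mul_I, Complex.sin_mul_I]
    generalize Complex.sinh ((π * r / 2 : ℝ) : ℂ) = S at *
    generalize Complex.cosh ((π * r / 2 : ℝ) : ℂ) = C at *
    have : Complex.I ≠ 0 := Complex.I_ne_zero
    field_simp
    rw [hI]
    linear_combination hcs
  have hs := ev.hasSum
  rw [val] at hs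
  have hs' := hs.mul_left (2 * Complex.I / π)
  have hpi : (π : ℂ) ≠ 0 := by exact_mod_cast Real.pi_ne_zero
  rw [← Complex.hasSum_ofReal]
  have V : (Real.tanh (π * r / 2) : ℂ) = 2 * Complex.I / π * (-(π / 2) * Complex.I * (Real.tanh (π * r / 2) : ℂ)) := by
    have hI := Complex.I_sq
    field_simp
    linear_combination ((Real.tanh (π * r / 2) : ℂ)) * hI
  rw [V]
  refine HasSum.congr_aux hs' (fun k => ?_)
  have hne1 := Complex.integerComplement_add_ne_zero h1 (2 * (k : ℤ) + 1)
  have hne2 := Complex.integerComplement_add_ne_zero h1 (-(2 * (k : ℤ) + 1))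
  have hI := Complex.I_sq
  have hne3 : (r : ℂ) ^ 2 + (2 * k + 1) ^ 2 = -((Complex.I * r - (2 * k + 1)) * (Complex.I * r + (2 * k + 1))) := by
    linear_combination ((r : ℂ) ^ 2) * hI
  simp only [cotTerm]
  push_cast at hne1 hne2 ⊢
  rw [← sub_eq_add_neg] at hne2
  rw [hne3]
  have hpq : (Complex.I * r - (2 * k + 1)) + (Complex.I * r + (2 * k + 1)) = 2 * Complex.I * r := by ring
  generalize Complex.I * (r : ℂ) - (2 * k + 1) = p at hne2 hpq ⊢
  generalize Complex.I * (r : ℂ) + (2 * k + 1) = q at hne1 hpq ⊢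
  have : 1 / p + 1 / q = 2 * Complex.I * r / (p * q) := by
    rw [← hpq]; field_simp; ring
  rw [this, div_neg]
  linear_combination (-4 / π * (r / (p * q)) : ℂ) * hI

lemma aux_int (a : ℝ) (ha : 0 < a) : Integrable (fun t : ℝ => (SignType.sign t : ℂ) * (Real.exp (-a * |t|) : ℂ)) ∧
    ∀ w : ℝ, 𝓕 (fun t : ℝ => (SignType.sign t : ℂ) * (Real.exp (-a * |t|) : ℂ)) w
      = -2 * Complex.I * ((2 * π * w / ((2 * π * w) ^ 2 + a ^ 2) : ℝ) : ℂ) := by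
  have i1 : ∀ w : ℝ, IntegrableOn (fun t : ℝ => Complex.exp (↑(-2 * π * t * w) * Complex.I) * ((SignType.sign t : ℂ) * (Real.exp (-a * |t|) : ℂ))) (Set.Ioi 0) ∧
      ∫ t in Set.Ioi (0:ℝ), Complex.exp (↑(-2 * π * t * w) * Complex.I) * ((SignType.sign t : ℂ) * (Real.exp (-a * |t|) : ℂ)) = 1 / (a + 2 * π * w * Complex.I) := by
    intro w
    have hz : (-a - 2 * π * w * Complex.I : ℂ).re < 0 := by simp [ha]
    have E : Set.EqOn (fun t : ℝ => Complex.exp ((-a - 2 * π * w * Complex.I : ℂ) * t)) (fun t : ℝ => Complex.exp (↑(-2 * π * t * w) * Complex.I) * ((SignType.sign t : ℂ) * (Real.exp (-a * |t|) : ℂ))) (Set.Ioi 0) := by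
      intro t ht
      have ht : 0 < t := ht
      simp only [sign_pos ht, abs_of_pos ht, SignType.coe_one, one_mul]
      rw [Complex.ofReal_exp, ← Complex.exp_add]
      congr 1
      push_cast
      ring
    refine ⟨(integrableOn_exp_mul_complex_Ioi hz 0).congr_fun E measurableSet_Ioi, ?_⟩
    rw [← setIntegral_congr_fun measurableSet_Ioi E, integral_exp_mul_complex_Ioi hz]
    rw [← neg_div_neg_eq]
    simp [add_comm]
  have i2 : ∀ w : ℝ, IntegrableOn (fun t : ℝ => Complex.exp (↑(-2 * π * t * w) * Complex.I) * ((SignType.sign t : ℂ) * (Real.exp (-a * |t|) : ℂ))) (Set.Iic 0) ∧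
      ∫ t in Set.Iic (0:ℝ), Complex.exp (↑(-2 * π * t * w) * Complex.I) * ((SignType.sign t : ℂ) * (Real.exp (-a * |t|) : ℂ)) = - (1 / (a - 2 * π * w * Complex.I)) := by
    intro w
    have hz : 0 < (a - 2 * π * w * Complex.I : ℂ).re := by simp [ha]
    have E : Set.EqOn (fun t : ℝ => -Complex.exp ((a - 2 * π * w * Complex.I : ℂ) * t)) (fun t : ℝ => Complex.exp (↑(-2 * π * t * w) * Complex.I) * ((SignType.sign t : ℂ) * (Real.exp (-a * |t|) : ℂ))) (Set.Iio 0) := by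
      intro t ht
      have ht : t < 0 := ht
      simp only [sign_neg ht, abs_of_neg ht, SignType.coe_neg_one, neg_mul, one_mul, mul_neg, neg_neg]
      rw [Complex.ofReal_exp, ← Complex.exp_add]
      congr 2
      push_cast
      ring
    refine ⟨?_, ?_⟩
    · rw [integrableOn_Iic_iff_integrableOn_Iio]
      exact (((integrableOn_exp_mul_complex_Iic hz 0).mono_set Set.Iio_subset_Iic_self).neg).congr_fun E measurableSet_Iio
    · rw [integral_Iic_eq_integral_Iio, ← setIntegral_congr_fun measurableSet_Iio E, ← integral_Iic_eq_integral_Iio, integral_neg, integral_exp_mul_complex_Iic hz]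
      simp
  have I : ∀ w : ℝ, Integrable (fun t : ℝ => Complex.exp (↑(-2 * π * t * w) * Complex.I) * ((SignType.sign t : ℂ) * (Real.exp (-a * |t|) : ℂ))) := by
    intro w
    rw [← integrableOn_univ, ← Set.Iic_union_Ioi (a := (0:ℝ))]
    exact (i2 w).1.union (i1 w).1
  refine ⟨by simpa using I 0, fun w => ?_⟩
  rw [Real.fourier_real_eq_integral_exp_smul]
  simp only [smul_eq_mul]
  rw [← intervalIntegral.integral_Iic_add_Ioi (i2 w).1 (i1 w).1, (i1 w).2, (i2 w).2]
  have n1 : (a + 2 * π * w * Complex.I : ℂ) ≠ 0 := fun h => by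
    have := congrArg Complex.re h; simp at this; exact ha.ne' this
  have n2 : (a - 2 * π * w * Complex.I : ℂ) ≠ 0 := fun h => by
    have := congrArg Complex.re h; simp at this; exact ha.ne' this
  have n3 : ((2 * π * w) ^ 2 + a ^ 2 : ℂ) = (a + 2 * π * w * Complex.I : ℂ) * (a - 2 * π * w * Complex.I : ℂ) := by
    linear_combination (4 * π ^ 2 * w ^ 2) * Complex.I_sq
  push_cast
  rw [n3]
  field_simp
  ring

lemma aux_summ : Summable (fun n : ℕ => 1 / (2 * (n : ℝ) + 1) ^ 2) := by
  have h : Summable (fun n : ℕ => 1 / ((n : ℝ)) ^ 2) := Real.summable_one_div_nat_pow.mpr (by norm_num)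
  have := h.comp_injective (i := fun k : ℕ => 2 * k + 1) (fun a b h => by simpa using h)
  simpa [Function.comp_def] using this

lemma aux_geom (t : ℝ) : HasSum (fun n : ℕ => (SignType.sign t : ℝ) * Real.exp (-(2 * (n : ℝ) + 1) * |t|))
    (1 / (2 * Real.sinh t)) := by
  have pos : ∀ s : ℝ, 0 < s → HasSum (fun n : ℕ => Real.exp (-(2 * (n : ℝ) + 1) * s)) (1 / (2 * Real.sinh s)) := by
    intro s hs
    have g := (hasSum_geometric_of_lt_one (Real.exp_pos (-2 * s)).le
      (by rw [Real.exp_lt_one_iff]; linarith)).mul_left (Real.exp (-s))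
    have e1 : (fun n : ℕ => Real.exp (-(2 * (n : ℝ) + 1) * s)) = fun n : ℕ => Real.exp (-s) * Real.exp (-2 * s) ^ n := by
      funext n
      rw [← Real.exp_nat_mul, ← Real.exp_add]
      congr 1; ring
    have e2 : 1 / (2 * Real.sinh s) = Real.exp (-s) * (1 - Real.exp (-2 * s))⁻¹ := by
      have h2 : Real.exp (-2 * s) = Real.exp (-s) * Real.exp (-s) := by
        rw [← Real.exp_add]; congr 1; ring
      have h3 : Real.exp s * Real.exp (-s) = 1 := by rw [← Real.exp_add]; simp
      have h4 : 0 < Real.sinh s := Real.sinh_pos_iff.mpr hs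
      have h5 : 1 - Real.exp (-2 * s) ≠ 0 := by
        have : Real.exp (-2 * s) < 1 := by rw [Real.exp_lt_one_iff]; linarith
        linarith
      rw [div_eq_iff (by positivity), mul_assoc, mul_comm, mul_assoc, eq_comm, inv_mul_eq_iff_eq_mul₀ h5,
        Real.sinh_eq, h2]
      linear_combination h3
    rw [e1, e2]; exact g
  rcases lt_trichotomy t 0 with h | h | h
  · have := (pos (-t) (by linarith)).neg
    simp only [sign_neg h, abs_of_neg h, SignType.coe_neg_one, neg_one_mul]
    have e : 1 / (2 * Real.sinh t) = -(1 / (2 * Real.sinh (-t))) := by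
      rw [Real.sinh_neg, mul_neg, div_neg, neg_neg]
    rw [e]; exact this
  · subst h; simp
  · simpa only [sign_pos h, abs_of_pos h, SignType.coe_one, one_mul] using pos t h

lemma aux_absexp (a : ℝ) (ha : 0 < a) : Integrable (fun t : ℝ => |t| * Real.exp (-a * |t|)) ∧
    ∫ t : ℝ, |t| * Real.exp (-a * |t|) = 2 * (1 / a ^ 2) := by
  have h : ∫ t : ℝ, |t| * Real.exp (-a * |t|) = 2 * (1 / a ^ 2) := by
    rw [integral_comp_abs (f := fun x => x * Real.exp (-a * x))]
    have := Real.integral_rpow_mul_exp_neg_mul_Ioi (a := 2) (r := a) (by norm_num) ha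
    rw [Real.Gamma_two] at this
    norm_num at this
    simpa using this
  refine ⟨?_, h⟩
  by_contra hc
  rw [integral_undef hc] at h
  have : 0 < 2 * (1 / a ^ 2) := by positivity
  linarith

lemma aux_rhs (f : ℝ → ℝ) (hc : Continuous f) (hsupp : HasCompactSupport f) (K : ℝ)
    (hK : ∀ t, |f t| ≤ K * |t|) :
    HasSum (fun n : ℕ => ∫ t : ℝ, (f t : ℂ) * ((SignType.sign t : ℂ) * (Real.exp (-(2 * (n : ℝ) + 1) * |t|) : ℂ)))
      (∫ t : ℝ, (f t : ℂ) * ((1 / (2 * Real.sinh t) : ℝ) : ℂ)) := by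
  have apos : ∀ n : ℕ, (0 : ℝ) < 2 * n + 1 := fun n => by positivity
  have bd : ∀ (n : ℕ) (t : ℝ), ‖(f t : ℂ) * ((SignType.sign t : ℂ) * (Real.exp (-(2 * (n : ℝ) + 1) * |t|) : ℂ))‖
      ≤ K * (|t| * Real.exp (-(2 * (n : ℝ) + 1) * |t|)) := by
    intro n t
    have hs : ‖(SignType.sign t : ℂ)‖ ≤ 1 := by
      cases SignType.sign t <;> simp
    rw [norm_mul, norm_mul, Complex.norm_real, Complex.norm_real, Real.norm_eq_abs, Real.norm_eq_abs, Real.abs_exp, ← mul_assoc K]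
    refine mul_le_mul (hK t) ?_ (by positivity) ((abs_nonneg _).trans (hK t))
    exact mul_le_of_le_one_left (by positivity) hs
  have hint : ∀ n : ℕ, Integrable (fun t : ℝ => (f t : ℂ) * ((SignType.sign t : ℂ) * (Real.exp (-(2 * (n : ℝ) + 1) * |t|) : ℂ))) := by
    intro n
    refine Integrable.mono' ((aux_absexp _ (apos n)).1.const_mul K) ?_ (Filter.Eventually.of_forall (bd n))
    exact (Complex.continuous_ofReal.comp hc).aestronglyMeasurable.mul (aux_int _ (apos n)).1.aestronglyMeasurable
  have hsum : Summable (fun n : ℕ => ∫ t : ℝ, ‖(f t : ℂ) * ((SignType.sign t : ℂ) * (Real.exp (-(2 * (n : ℝ) + 1) * |t|) : ℂ))‖) := by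
    refine Summable.of_nonneg_of_le (fun n => integral_nonneg fun _ => norm_nonneg _) (fun n => ?_)
      ((aux_summ.mul_left 2).mul_left K)
    rw [← (aux_absexp _ (apos n)).2, ← integral_const_mul]
    exact integral_mono (hint n).norm ((aux_absexp _ (apos n)).1.const_mul K) (bd n)
  have := hasSum_integral_of_summable_integral_norm hint hsum
  suffices e : (∫ t : ℝ, (f t : ℂ) * ((1 / (2 * Real.sinh t) : ℝ) : ℂ)) = ∫ t : ℝ, ∑' n : ℕ, (f t : ℂ) * ((SignType.sign t : ℂ) * (Real.exp (-(2 * (n : ℝ) + 1) * |t|) : ℂ)) by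
    rw [e]; exact this
  refine integral_congr_ae (Filter.Eventually.of_forall fun t => ?_)
  have g := (Complex.hasSum_ofReal.mpr (aux_geom t)).mul_left (f t : ℂ)
  simp only
  rw [← g.tsum_eq]
  refine tsum_congr fun n => ?_
  push_cast
  congr 2
  cases SignType.sign t <;> simp

lemma aux_lhs (ψ : ℝ → ℂ) (hψ : Integrable (fun w => w * ψ w)) (hc : Continuous ψ) :
    HasSum (fun n : ℕ => ∫ w : ℝ, ψ w * (((4 / π) * (2 * π * w / ((2 * π * w) ^ 2 + (2 * (n : ℝ) + 1) ^ 2)) : ℝ) : ℂ))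
      (∫ w : ℝ, ψ w * (Real.tanh (π * (2 * π * w) / 2) : ℂ)) := by
  have apos : ∀ n : ℕ, (0 : ℝ) < 2 * n + 1 := fun n => by positivity
  have bd : ∀ (n : ℕ) (w : ℝ), ‖ψ w * (((4 / π) * (2 * π * w / ((2 * π * w) ^ 2 + (2 * (n : ℝ) + 1) ^ 2)) : ℝ) : ℂ)‖
      ≤ (8 * ‖w * ψ w‖) * (1 / (2 * (n : ℝ) + 1) ^ 2) := by
    intro n w
    have ha := apos n
    rw [norm_mul, norm_mul, Complex.norm_real, Complex.norm_real, Real.norm_eq_abs, Real.norm_eq_abs, abs_mul, abs_div,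
      abs_div, abs_mul, abs_of_pos (show (0:ℝ) < (2 * π * w) ^ 2 + (2 * (n : ℝ) + 1) ^ 2 by positivity),
      abs_of_pos (show (0:ℝ) < 2 * π by positivity), abs_of_pos Real.pi_pos, abs_of_pos (show (0:ℝ) < 4 by norm_num)]
    calc ‖ψ w‖ * (4 / π * (2 * π * |w| / ((2 * π * w) ^ 2 + (2 * (n : ℝ) + 1) ^ 2)))
        ≤ ‖ψ w‖ * (4 / π * (2 * π * |w| / ((2 * (n : ℝ) + 1) ^ 2))) := by
          gcongr
          nlinarith [sq_nonneg (2 * π * w)]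
      _ = _ := by field_simp; ring
  have hint : ∀ n : ℕ, Integrable (fun w : ℝ => ψ w * (((4 / π) * (2 * π * w / ((2 * π * w) ^ 2 + (2 * (n : ℝ) + 1) ^ 2)) : ℝ) : ℂ)) := by
    intro n
    refine Integrable.mono' ((hψ.norm.const_mul 8).mul_const _) ?_ (Filter.Eventually.of_forall (bd n))
    refine Continuous.aestronglyMeasurable (hc.mul (Complex.continuous_ofReal.comp ?_))
    refine continuous_const.mul (Continuous.div (by fun_prop) (by fun_prop) fun w => ?_)
    have := apos n
    positivity
  have hsum : Summable (fun n : ℕ => ∫ w : ℝ, ‖ψ w * (((4 / π) * (2 * π * w / ((2 * π * w) ^ 2 + (2 * (n : ℝ) + 1) ^ 2)) : ℝ) : ℂ)‖) := by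
    refine Summable.of_nonneg_of_le (fun n => integral_nonneg fun _ => norm_nonneg _) (fun n => ?_)
      (aux_summ.mul_left (∫ w : ℝ, 8 * ‖w * ψ w‖))
    rw [← integral_mul_const]
    exact integral_mono (hint n).norm ((hψ.norm.const_mul 8).mul_const _) (bd n)
  have := hasSum_integral_of_summable_integral_norm hint hsum
  suffices e : (∫ w : ℝ, ψ w * (Real.tanh (π * (2 * π * w) / 2) : ℂ)) = ∫ w : ℝ, ∑' n : ℕ, ψ w * (((4 / π) * (2 * π * w / ((2 * π * w) ^ 2 + (2 * (n : ℝ) + 1) ^ 2)) : ℝ) : ℂ) by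
    rw [e]; exact this
  refine integral_congr_ae (Filter.Eventually.of_forall fun w => ?_)
  exact ((Complex.hasSum_ofReal.mpr (aux_tanh (2 * π * w))).mul_left (ψ w)).tsum_eq.symm

/-- For a smooth compactly supported odd function `f : ℝ → ℝ`, the iterated integral
`∫_ℝ (∫_ℝ f(t) e^{iρt} dt) tanh(πρ/2) dρ = ∫_ℝ f(t) · (2i / sinh t) dt`. -/
theorem fourier_tanh_pairing (f : ℝ → ℝ) (hsm : ContDiff ℝ (⊤ : ℕ∞) f)
    (hsupp : HasCompactSupport f) (hodd : ∀ t, f (-t) = -f t) :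
    (∫ ρ : ℝ, (∫ t : ℝ, (f t : ℂ) * Complex.exp (Complex.I * (ρ : ℂ) * (t : ℂ)))
        * (Real.tanh (π * ρ / 2) : ℂ))
      = ∫ t : ℝ, (f t : ℂ) * (2 * Complex.I / (Real.sinh t : ℂ)) := by
  have f0 : f 0 = 0 := by have := hodd 0; simp at this; linarith
  obtain ⟨C, hC⟩ := ContDiff.lipschitzWith_of_hasCompactSupport hsupp hsm (by simp)
  have hK : ∀ t, |f t| ≤ (C : ℝ) * |t| := by
    intro t
    have := hC.dist_le_mul t 0
    simpa [f0, Real.dist_eq] using this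
  have hs1 : HasCompactSupport (fun t => (f t : ℂ)) := hsupp.comp_left (g := fun x : ℝ => (x : ℂ)) (by simp)
  have hs2 : ContDiff ℝ (⊤ : ℕ∞) (fun t => (f t : ℂ)) := Complex.ofRealCLM.contDiff.comp hsm
  let φ : SchwartzMap ℝ ℂ := hs1.toSchwartzMap hs2
  have hφ : ∀ t, φ t = (f t : ℂ) := fun t => rfl
  let ψ : SchwartzMap ℝ ℂ := 𝓕⁻ φ
  have hψφ : ∀ t, 𝓕 (ψ : ℝ → ℂ) t = (f t : ℂ) := by
    intro t
    rw [← SchwartzMap.fourier_coe]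
    simp only [ψ, FourierTransform.fourier_fourierInv_eq, hφ]
  have hψ : ∀ w, (∫ t : ℝ, (f t : ℂ) * Complex.exp (Complex.I * ((2 * π * w : ℝ) : ℂ) * (t : ℂ))) = ψ w := by
    intro w
    simp only [ψ]
    rw [SchwartzMap.fourierInv_coe, Real.fourierInv_eq']
    refine integral_congr_ae (Filter.Eventually.of_forall fun t => ?_)
    simp only [hφ, smul_eq_mul]
    rw [mul_comm]
    congr 2
    simp
    ring
  have hψi : Integrable (fun w : ℝ => (w : ℂ) * ψ w) := by
    have := ψ.integrable_pow_mul volume 1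
    refine (integrable_norm_iff ?_).mp ?_
    · exact (Complex.continuous_ofReal.mul ψ.continuous).aestronglyMeasurable
    · simpa using this
  have L := aux_lhs ψ hψi ψ.continuous
  have R := (aux_rhs f hsm.continuous hsupp C hK).mul_left (2 * Complex.I / π)
  have key : ∀ n : ℕ, ∫ w : ℝ, ψ w * (((4 / π) * (2 * π * w / ((2 * π * w) ^ 2 + (2 * (n : ℝ) + 1) ^ 2)) : ℝ) : ℂ)
      = (2 * Complex.I / π) * ∫ t : ℝ, (f t : ℂ) * ((SignType.sign t : ℂ) * (Real.exp (-(2 * (n : ℝ) + 1) * |t|) : ℂ)) := by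
    intro n
    obtain ⟨hi, hF⟩ := aux_int (2 * (n : ℝ) + 1) (by positivity)
    have sa := VectorFourier.integral_fourierIntegral_smul_eq_flip (L := innerₗ ℝ) (μ := volume) (ν := volume)
      Real.continuous_fourierChar continuous_inner ψ.integrable hi
    have sa' : ∫ t : ℝ, 𝓕 (ψ : ℝ → ℂ) t * ((SignType.sign t : ℂ) * (Real.exp (-(2 * (n : ℝ) + 1) * |t|) : ℂ))
      = ∫ w : ℝ, ψ w * 𝓕 (fun t : ℝ => (SignType.sign t : ℂ) * (Real.exp (-(2 * (n : ℝ) + 1) * |t|) : ℂ)) w := by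
      simpa using! sa
    simp only [hψφ, hF] at sa'
    rw [sa', ← integral_const_mul]
    refine integral_congr_ae (Filter.Eventually.of_forall fun w => ?_)
    have hI := Complex.I_sq
    simp only
    push_cast
    linear_combination (4 / π * ψ w * (2 * π * w / ((2 * π * w) ^ 2 + (2 * (n : ℂ) + 1) ^ 2))) * hI
  simp only [key] at L
  have E := L.unique R
  have cv := Measure.integral_comp_mul_left (fun ρ : ℝ => (∫ t : ℝ, (f t : ℂ) * Complex.exp (Complex.I * (ρ : ℂ) * (t : ℂ)))
        * (Real.tanh (π * ρ / 2) : ℂ)) (2 * π)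
  simp only [hψ] at cv
  rw [E] at cv
  have p2 : (0 : ℝ) < 2 * π := by positivity
  have hpi : (π : ℂ) ≠ 0 := by exact_mod_cast Real.pi_ne_zero
  rw [abs_of_pos (inv_pos.mpr p2), eq_inv_smul_iff₀ p2.ne'] at cv
  rw [← cv, Complex.real_smul, ← mul_assoc, ← integral_const_mul]
  refine integral_congr_ae (Filter.Eventually.of_forall fun t => ?_)
  simp only
  push_cast
  field_simp
end
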